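/- arXiv:math/0611356 — 3 statements merged into one kernel-verified Lean document; each statement's English description precedes it below -/
import Mathlib

section
/- Let $n \ge 1$ and let $X \subset \mathbb{Z}_+^n$ be a set of points with nonnegative integer coordinates that has the separation property: for any two distinct points $x = (x_1,\dots,x_n)$ and $y = (y_1,\dots,y_n)$ in $X$ there is an index $j$ with $2y_j < x_j$. Let $k_1,\dots,k_{n-1} \ge 1$ be real numbers such that $x_j \le k_j - 1$ for all $x \in X$ and $j = 1,\dots,n-1$. Then $X$ is finite and $$|X| \le \prod_{j=1}^{n-1} \bigl(1 + \log_2 k_j\bigr).$$ -/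
/-- A set `X` of integer points has the *separation property* if for any two distinct
points `x, y ∈ X` there is an index `j` with `2 * y j < x j`. -/
def SeparationProperty {n : ℕ} (X : Set (Fin n → ℤ)) : Prop :=
  ∀ x ∈ X, ∀ y ∈ X, x ≠ y → ∃ j, 2 * y j < x j

open MeasureTheory in
/-- Points of the box `∏ [0, L i]` that pairwise differ by at least `1` in some coordinate number
at most `∏ (1 + L i)`: the half-open unit cubes at these points are disjoint. -/
theorem card_le_prod_of_one_le_abs_sub {ι α : Type*} [Fintype ι] (F : Finset α)
    (u : α → ι → ℝ) (L : ι → ℝ) (hL : ∀ i, 0 ≤ L i)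
    (hu0 : ∀ a ∈ F, ∀ i, 0 ≤ u a i) (huL : ∀ a ∈ F, ∀ i, u a i ≤ L i)
    (hsep : ∀ a ∈ F, ∀ b ∈ F, a ≠ b → ∃ i, 1 ≤ |u a i - u b i|) :
    (F.card : ℝ) ≤ ∏ i, (1 + L i) := by
  let Q : α → Set (ι → ℝ) := fun a => Set.univ.pi fun i => Set.Ico (u a i) (u a i + 1)
  have hdisj : (F : Set α).PairwiseDisjoint Q := by
    intro a ha b hb hab
    obtain ⟨i, hi⟩ := hsep a ha b hb hab
    refine Set.disjoint_left.2 fun z hza hzb => ?_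
    obtain ⟨h1, h2⟩ := hza i (Set.mem_univ i)
    obtain ⟨h3, h4⟩ := hzb i (Set.mem_univ i)
    exact absurd hi (not_le.2 (abs_sub_lt_iff.2 ⟨by linarith, by linarith⟩))
  have hmeas : ∀ a ∈ F, MeasurableSet (Q a) := fun a _ =>
    MeasurableSet.univ_pi fun _ => measurableSet_Ico
  have hvol : ∀ a, volume (Q a) = 1 := fun a => by
    simp [Q, Real.volume_pi_Ico]
  have hsub : (⋃ a ∈ F, Q a) ⊆ Set.univ.pi fun i => Set.Ico (0 : ℝ) (1 + L i) := by
    refine Set.iUnion₂_subset fun a ha z hz i hi => ?_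
    obtain ⟨h1, h2⟩ := hz i hi
    have := hu0 a ha i
    have := huL a ha i
    exact ⟨by linarith, by linarith⟩
  have hle := measure_mono (μ := volume) hsub
  have hpos : ∀ i ∈ Finset.univ, 0 ≤ 1 + L i := fun i _ => by linarith [hL i]
  rw [measure_biUnion_finset hdisj hmeas, Finset.sum_congr rfl fun a _ => hvol a,
    Real.volume_pi_Ico] at hle
  simp only [sub_zero, Finset.sum_const, nsmul_eq_mul, mul_one] at hle
  rw [← ENNReal.ofReal_prod_of_nonneg hpos, ← ENNReal.ofReal_natCast] at hle
  exact (ENNReal.ofReal_le_ofReal_iff (Finset.prod_nonneg hpos)).1 hle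

/-- For nonnegative integers, `2 b < a` means that `1 + a` is at least twice `1 + b`. -/
theorem one_le_logb_sub_logb_of_two_mul_lt {a b : ℤ} (hb : 0 ≤ b) (h : 2 * b < a) :
    1 ≤ Real.logb 2 (1 + a) - Real.logb 2 (1 + b) := by
  have hb' : (0 : ℝ) < 1 + b := by exact_mod_cast (by lia : 0 < 1 + b)
  have h' : 2 * (1 + b : ℝ) ≤ 1 + a := by exact_mod_cast (by lia : 2 * (1 + b) ≤ 1 + a)
  have := Real.logb_le_logb_of_le one_lt_two (by positivity) h'
  rw [Real.logb_mul two_ne_zero hb'.ne', Real.logb_self_eq_one one_lt_two] at this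
  linarith

/-- In a set of nonnegative points with the separation property, distinct points are separated
already in one of the coordinates other than the last. -/
theorem SeparationProperty.exists_lt_or_lt {n : ℕ} {X : Set (Fin n → ℤ)}
    (hsep : SeparationProperty X) (hpos : ∀ x ∈ X, ∀ j, 0 ≤ x j) {x y : Fin n → ℤ}
    (hx : x ∈ X) (hy : y ∈ X) (hxy : x ≠ y) :
    ∃ j : Fin n, (j : ℕ) + 1 < n ∧ (2 * y j < x j ∨ 2 * x j < y j) := by
  obtain ⟨i, hi⟩ := hsep x hx y hy hxy
  obtain ⟨j, hj⟩ := hsep y hy x hx hxy.symm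
  by_cases hin : (i : ℕ) + 1 < n
  · exact ⟨i, hin, Or.inl hi⟩
  by_cases hjn : (j : ℕ) + 1 < n
  · exact ⟨j, hjn, Or.inr hj⟩
  obtain rfl : i = j := Fin.ext (by lia)
  have := hpos x hx i
  have := hpos y hy i
  lia

theorem card_le_of_separationProperty (n : ℕ) (X : Set (Fin n → ℤ))
    (hpos : ∀ x ∈ X, ∀ j, 0 ≤ x j)
    (hsep : SeparationProperty X)
    (k : Fin n → ℝ)
    (hk : ∀ j : Fin n, (j : ℕ) + 1 < n → 1 ≤ k j)
    (hbd : ∀ x ∈ X, ∀ j : Fin n, (j : ℕ) + 1 < n → (x j : ℝ) ≤ k j - 1) :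
    X.Finite ∧
      (X.ncard : ℝ) ≤
        ∏ j ∈ Finset.univ.filter (fun j : Fin n => (j : ℕ) + 1 < n),
          (1 + Real.logb 2 (k j)) := by
  rw [Finset.prod_subtype (p := fun j : Fin n => (j : ℕ) + 1 < n) _ (by simp)]
  set B : ℝ := ∏ j : {j : Fin n // (j : ℕ) + 1 < n}, (1 + Real.logb 2 (k j))
  have hcard : ∀ F : Finset (Fin n → ℤ), (F : Set (Fin n → ℤ)) ⊆ X → (F.card : ℝ) ≤ B := by
    intro F hF
    have hone : ∀ x ∈ F, ∀ j, (1 : ℝ) ≤ 1 + x j := fun x hx j => by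
      exact_mod_cast (by linarith [hpos x (hF hx) j] : 1 ≤ 1 + x j)
    refine card_le_prod_of_one_le_abs_sub F
      (fun x (j : {j : Fin n // (j : ℕ) + 1 < n}) => Real.logb 2 (1 + x j)) _
      (fun j => Real.logb_nonneg one_lt_two (hk j j.2))
      (fun x hx j => Real.logb_nonneg one_lt_two (hone x hx j))
      (fun x hx j => Real.logb_le_logb_of_le one_lt_two (by linarith [hone x hx j])
        (by linarith [hbd x (hF hx) j j.2])) ?_
    intro x hx y hy hxy
    obtain ⟨j, hj, h | h⟩ := hsep.exists_lt_or_lt hpos (hF hx) (hF hy) hxy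
    · exact ⟨⟨j, hj⟩, le_abs.2 <| Or.inl <|
        one_le_logb_sub_logb_of_two_mul_lt (hpos y (hF hy) j) h⟩
    · refine ⟨⟨j, hj⟩, le_abs.2 <| Or.inr ?_⟩
      rw [neg_sub]
      exact one_le_logb_sub_logb_of_two_mul_lt (hpos x (hF hx) j) h
  have hfin : X.Finite := by
    by_contra hinf
    obtain ⟨m, hm⟩ := exists_nat_gt B
    obtain ⟨F, hF, rfl⟩ := Set.Infinite.exists_subset_card_eq hinf m
    exact absurd (hcard F hF) (not_le.2 hm)
  refine ⟨hfin, ?_⟩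
  rw [Set.ncard_eq_toFinset_card X hfin]
  exact hcard _ (by simp)
end

section
/- Let $A \in \mathbb{Z}^{m\times n}$ and $b \in \mathbb{Z}^m$, let $r$ be the rank of $A$, and let $\alpha$ be the maximum of the moduli of the coefficients in the system $Ax = b$ (the entries of $A$ and of $b$). Let $N'(A,b)$ be the set of vertices (extreme points) of the convex hull in $\mathbb{R}^n$ of $\{x \in \mathbb{Z}^n : Ax = b,\ x \ge 0\}$. Then $N'(A,b)$ is finite and $$|N'(A,b)| \le \bigl(1 + \log_2 n + r \log_2(\alpha\sqrt{r})\bigr)^{n-1},$$ where the term $r\log_2(\alpha\sqrt r)$ is read as $0$ if $r = 0$. -/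
/-- The set `{x ∈ ℤⁿ : Ax = b, x ≥ 0}`, viewed inside `ℝⁿ`. -/
def eqIntPoints (m n : ℕ) (A : Matrix (Fin m) (Fin n) ℤ) (b : Fin m → ℤ) :
    Set (Fin n → ℝ) :=
  {x | (∀ j, ∃ z : ℤ, x j = (z : ℝ)) ∧
       (∀ i, ∑ j, (A i j : ℝ) * x j = (b i : ℝ)) ∧ ∀ j, 0 ≤ x j}

/-- `N′(A,b)`: the set of vertices (extreme points) of the convex hull of
`{x ∈ ℤⁿ : Ax = b, x ≥ 0}`. -/
def vertN' (m n : ℕ) (A : Matrix (Fin m) (Fin n) ℤ) (b : Fin m → ℤ) :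
    Set (Fin n → ℝ) :=
  Set.extremePoints ℝ (convexHull ℝ (eqIntPoints m n A b))

open scoped Matrix

/-- **Hadamard's inequality** for an integer matrix with entries of modulus at most `α`. -/
theorem abs_det_le_hadamard {τ : Type*} [Fintype τ] [DecidableEq τ] (M : Matrix τ τ ℤ) (α : ℕ)
    (hM : ∀ i j, (M i j).natAbs ≤ α) :
    ((M.det.natAbs : ℕ) : ℝ) ≤ (α * Real.sqrt (Fintype.card τ)) ^ Fintype.card τ := by
  set s := Fintype.card τ with hs
  let e : τ ≃ Fin s := Fintype.equivFin τ
  let N : Matrix (Fin s) (Fin s) ℝ := (M.reindex e e).map (Int.cast : ℤ → ℝ)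
  have hN : N.det = (M.det : ℝ) := by
    rw [← Matrix.det_reindex_self e M]
    exact (Int.cast_det _).symm
  let E := EuclideanSpace ℝ (Fin s)
  have : Fact (Module.finrank ℝ E = s) := ⟨by simp [E]⟩
  let b : OrthonormalBasis (Fin s) ℝ E := EuclideanSpace.basisFun (Fin s) ℝ
  let v : Fin s → E := fun j => WithLp.toLp 2 (fun i => N i j)
  have hdet : b.toBasis.det v = N.det := by
    rw [Module.Basis.det_apply]
    congr 1
  have h1 : |N.det| ≤ ∏ j, ‖v j‖ := by
    rw [← hdet, ← b.toBasis.orientation.volumeForm_robust' b v]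
    exact b.toBasis.orientation.abs_volumeForm_apply_le v
  have h2 : ∀ j, ‖v j‖ ≤ α * Real.sqrt s := by
    intro j
    rw [EuclideanSpace.norm_eq]
    have hα : (α : ℝ) = Real.sqrt ((α : ℝ) ^ 2) := (Real.sqrt_sq (Nat.cast_nonneg α)).symm
    rw [hα, ← Real.sqrt_mul (by positivity)]
    apply Real.sqrt_le_sqrt
    calc ∑ i, ‖v j i‖ ^ 2 ≤ ∑ _i : Fin s, (α : ℝ) ^ 2 := by
          apply Finset.sum_le_sum
          intro i _
          have h3 : ‖v j i‖ = (((M (e.symm i) (e.symm j)).natAbs : ℕ) : ℝ) := by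
            simp [v, N, Nat.cast_natAbs]
          rw [h3]
          have := hM (e.symm i) (e.symm j)
          gcongr
      _ = (α : ℝ) ^ 2 * s := by simp [mul_comm]
  calc ((M.det.natAbs : ℕ) : ℝ) = |N.det| := by rw [hN, Nat.cast_natAbs, Int.cast_abs]
    _ ≤ ∏ j, ‖v j‖ := h1
    _ ≤ ∏ _j : Fin s, (α * Real.sqrt s) := Finset.prod_le_prod (fun _ _ => norm_nonneg _)
        fun j _ => h2 j
    _ = _ := by simp

/-- A matrix with linearly independent columns has a nonsingular maximal square submatrix. -/
theorem exists_submatrix_det_ne_zero {κ τ : Type*} [Fintype κ] [Fintype τ] [DecidableEq τ]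
    (B : Matrix κ τ ℝ) (hB : LinearIndependent ℝ B.col) :
    ∃ f : τ → κ, (B.submatrix f id).det ≠ 0 := by
  classical
  have hrank : Module.finrank ℝ (Submodule.span ℝ (Set.range B.row)) = Fintype.card τ := by
    rw [← Matrix.rank_eq_finrank_span_row, Matrix.rank_eq_finrank_span_cols]
    exact finrank_span_eq_card hB
  obtain ⟨κ', a, ha, hspan, hli⟩ := exists_linearIndependent' ℝ B.row
  have : Fintype κ' := Fintype.ofInjective a ha
  have hcard : Fintype.card κ' = Fintype.card τ := by
    rw [← hrank, ← hspan]
    exact (finrank_span_eq_card hli).symm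
  let e : τ ≃ κ' := Fintype.equivOfCardEq hcard.symm
  refine ⟨a ∘ e, ?_⟩
  have : LinearIndependent ℝ (B.submatrix (a ∘ e) id).row := hli.comp e e.injective
  rw [Matrix.linearIndependent_rows_iff_isUnit, Matrix.isUnit_iff_isUnit_det] at this
  exact this.ne_zero

/-- A nonnegative kernel vector with minimal support is proportional to a natural vector whose
entries are bounded by Hadamard's inequality. -/
theorem exists_nat_circuit {κ ι : Type*} [Fintype κ] [Fintype ι]
    (B : Matrix κ ι ℤ) (α r : ℕ) (hα : 1 ≤ α) (hB : ∀ i j, (B i j).natAbs ≤ α)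
    (hr : (B.map (Int.cast : ℤ → ℝ)).rank ≤ r) (c : ι → ℝ) (hc0 : ∀ j, 0 ≤ c j)
    (hc : B.map (Int.cast : ℤ → ℝ) *ᵥ c = 0) (hne : c ≠ 0)
    (hmin : ∀ w, B.map (Int.cast : ℤ → ℝ) *ᵥ w = 0 → (∀ j, c j = 0 → w j = 0) →
      (∃ j, c j ≠ 0 ∧ w j = 0) → w = 0) :
    ∃ d : ι → ℕ, d ≠ 0 ∧ (∀ j, c j = 0 → d j = 0) ∧
      (∀ j, d j ≤ ⌊(α * Real.sqrt r) ^ r⌋₊) ∧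
      B.map (Int.cast : ℤ → ℝ) *ᵥ (fun j => (d j : ℝ)) = 0 := by
  classical
  set R := B.map (Int.cast : ℤ → ℝ) with hR
  obtain ⟨j₀, hj₀⟩ : ∃ j, c j ≠ 0 := Function.ne_iff.1 hne
  have hpos : 0 < c j₀ := lt_of_le_of_ne (hc0 j₀) hj₀.symm
  let τ := {j // c j ≠ 0 ∧ j ≠ j₀}
  have hsum : ∀ g : ι → ℝ, (∀ j, c j = 0 → g j = 0) →
      ∑ j, g j = g j₀ + ∑ t : τ, g t := by
    intro g hg
    rw [← Finset.add_sum_erase _ _ (Finset.mem_univ j₀)]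
    congr 1
    rw [← Finset.sum_subtype (Finset.univ.filter fun j => c j ≠ 0 ∧ j ≠ j₀) (by simp) g]
    refine (Finset.sum_subset (fun j hj => ?_) fun j hj hj' => hg j ?_).symm
    · simp only [Finset.mem_filter, Finset.mem_univ, true_and] at hj
      simp [hj.2]
    · simp only [Finset.mem_erase, Finset.mem_univ, and_true] at hj
      simpa [hj] using hj'
  let C : Matrix κ τ ℝ := R.submatrix id (fun t : τ => (t : ι))
  have hli : LinearIndependent ℝ C.col := by
    rw [Fintype.linearIndependent_iff]
    intro g hg
    let w : ι → ℝ := fun j => if h : c j ≠ 0 ∧ j ≠ j₀ then g ⟨j, h⟩ else 0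
    have hw : ∀ t : τ, w t = g t := fun t => dif_pos t.2
    have hw₀ : w j₀ = 0 := by simp [w]
    have hw1 : ∀ j, c j = 0 → w j = 0 := fun j hj => by simp [w, hj]
    have hw0 : w = 0 := by
      refine hmin w ?_ hw1 ⟨j₀, hj₀, hw₀⟩
      funext i
      have := congrFun hg i
      simp only [Finset.sum_apply, Pi.smul_apply, smul_eq_mul, Pi.zero_apply] at this
      rw [Matrix.mulVec, dotProduct, hsum _ (fun j hj => by simp [hw1 j hj]), hw₀]
      simp only [mul_zero, zero_add, hw, Pi.zero_apply]
      refine Eq.trans ?_ this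
      exact Finset.sum_congr rfl fun t _ => mul_comm _ _
    intro t
    rw [← hw t, hw0]; rfl
  have hcard : Fintype.card τ ≤ r := by
    calc Fintype.card τ = C.rank := by
          rw [Matrix.rank_eq_finrank_span_cols]; exact (finrank_span_eq_card hli).symm
      _ ≤ R.rank := Matrix.rank_submatrix_le _ _ _
      _ ≤ r := hr
  obtain ⟨f, hf⟩ := exists_submatrix_det_ne_zero C hli
  let M : Matrix τ τ ℤ := B.submatrix f (fun t : τ => (t : ι))
  have hMR : C.submatrix f id = M.map (Int.cast : ℤ → ℝ) := rfl
  let q : τ → ℤ := fun t => B (f t) j₀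
  let u : τ → ℤ := M.cramer q
  have hdet : (M.map (Int.cast : ℤ → ℝ)).det = (M.det : ℝ) := (Int.cast_det _).symm
  have hcr : ∀ t, (M.map (Int.cast : ℤ → ℝ)).cramer (fun t => (q t : ℝ)) t = (u t : ℝ) := by
    intro t
    simp only [u, Matrix.cramer_apply]
    rw [Int.cast_det]
    congr 1
    ext i j
    by_cases h : j = t <;> simp [h]
  have hker : M.map (Int.cast : ℤ → ℝ) *ᵥ (fun t : τ => c t) = (-c j₀) • fun t => (q t : ℝ) := by
    funext i
    have := congrFun hc (f i)
    rw [Matrix.mulVec, dotProduct, hsum _ (fun j hj => by simp [hj])] at this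
    simp only [Matrix.mulVec, dotProduct, Pi.smul_apply, smul_eq_mul, Pi.zero_apply] at this ⊢
    simp only [hR, Matrix.map_apply] at this
    simp only [M, Matrix.map_apply, Matrix.submatrix_apply, q]
    linarith
  have hprop : ∀ t : τ, (M.det : ℝ) * c t = -c j₀ * u t := by
    intro t
    have h1 := congrArg (fun v => ((M.map (Int.cast : ℤ → ℝ)).adjugate *ᵥ v) t) hker
    simp only [Matrix.mulVec_mulVec, Matrix.adjugate_mul, hdet, Matrix.mulVec_smul,
      ← Matrix.cramer_eq_adjugate_mulVec, Pi.smul_apply, hcr, smul_eq_mul] at h1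
    simpa [Matrix.smul_mulVec] using h1
  let d : ι → ℕ := fun j => if h : c j ≠ 0 ∧ j ≠ j₀ then (u ⟨j, h⟩).natAbs else
    if j = j₀ then M.det.natAbs else 0
  have hd₀ : d j₀ = M.det.natAbs := by simp [d]
  have hdc : ∀ j, (d j : ℝ) = (|(M.det : ℝ)| / c j₀) * c j := by
    intro j
    by_cases h : c j ≠ 0 ∧ j ≠ j₀
    · have h1 : d j = (u ⟨j, h⟩).natAbs := dif_pos h
      have h2 := congrArg abs (hprop ⟨j, h⟩)
      rw [abs_mul, abs_mul, abs_neg, abs_of_pos hpos, abs_of_nonneg (hc0 _)] at h2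
      rw [h1, Nat.cast_natAbs, Int.cast_abs, div_mul_eq_mul_div, h2]
      field_simp
    · by_cases hj : j = j₀
      · subst hj
        rw [hd₀, Nat.cast_natAbs, Int.cast_abs]
        field_simp
      · have : c j = 0 := by tauto
        simp [d, this, hj]
  have hD : ∀ N : Matrix τ τ ℤ, (∀ i j, (N i j).natAbs ≤ α) →
      N.det.natAbs ≤ ⌊(α * Real.sqrt r) ^ r⌋₊ := by
    intro N hN
    apply Nat.le_floor
    refine (abs_det_le_hadamard N α hN).trans ?_
    rcases Nat.eq_zero_or_pos (Fintype.card τ) with h0 | h0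
    · rw [h0, pow_zero]
      rcases Nat.eq_zero_or_pos r with hr0 | hr0
      · simp [hr0]
      · apply one_le_pow₀
        have : (1 : ℝ) ≤ Real.sqrt r := Real.one_le_sqrt.2 (by exact_mod_cast hr0)
        have h3 : (1 : ℝ) ≤ α := by exact_mod_cast hα
        nlinarith
    · have h4 : (1 : ℝ) ≤ Real.sqrt r := Real.one_le_sqrt.2 (by exact_mod_cast h0.trans_le hcard)
      have h3 : (1 : ℝ) ≤ α := by exact_mod_cast hα
      calc (α * Real.sqrt (Fintype.card τ)) ^ Fintype.card τ
          ≤ (α * Real.sqrt r) ^ Fintype.card τ := by gcongr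
        _ ≤ (α * Real.sqrt r) ^ r := pow_le_pow_right₀ (by nlinarith) hcard
  refine ⟨d, ?_, ?_, ?_, ?_⟩
  · refine Function.ne_iff.2 ⟨j₀, ?_⟩
    rw [hd₀]
    rw [hMR, hdet] at hf
    simpa using hf
  · intro j hj
    have := hdc j
    rw [hj, mul_zero] at this
    exact_mod_cast this
  · intro j
    simp only [d]
    split_ifs with h h'
    · simp only [u, Matrix.cramer_apply]
      apply hD
      intro i k
      rw [Matrix.updateCol_apply]
      split_ifs
      · exact hB _ _
      · exact hB _ _
    · exact hD _ fun i k => hB _ _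
    · exact Nat.zero_le _
  · have : (fun j => (d j : ℝ)) = (|(M.det : ℝ)| / c j₀) • c := funext hdc
    rw [this, Matrix.mulVec_smul, hc, smul_zero]

/-- Move from `z ≥ 0` in direction `-w` until a coordinate of the support vanishes. -/
theorem exists_pos_sub_smul_nonneg {ι : Type*} [Fintype ι] (z w : ι → ℝ) (hz : ∀ j, 0 ≤ z j)
    (hw : ∀ j, z j = 0 → w j = 0) (hpos : ∃ j, 0 < w j) :
    ∃ t : ℝ, 0 < t ∧ (∀ j, 0 ≤ z j - t * w j) ∧ ∃ j, z j ≠ 0 ∧ z j - t * w j = 0 := by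
  classical
  obtain ⟨j₁, hj₁⟩ := hpos
  obtain ⟨j, hj, hmin⟩ := Finset.exists_min_image (Finset.univ.filter fun j => 0 < w j)
    (fun j => z j / w j) ⟨j₁, by simpa using hj₁⟩
  simp only [Finset.mem_filter, Finset.mem_univ, true_and] at hj hmin
  have hzj : z j ≠ 0 := fun h => hj.ne' (hw j h)
  have hzpos : 0 < z j := lt_of_le_of_ne (hz j) hzj.symm
  refine ⟨z j / w j, div_pos hzpos hj, fun i => ?_, j, hzj, by field_simp; simp⟩
  rcases le_or_gt (w i) 0 with h | h
  · have : z j / w j * w i ≤ 0 := mul_nonpos_of_nonneg_of_nonpos (div_pos hzpos hj).le h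
    linarith [hz i]
  · have := (le_div_iff₀ h).1 (hmin i h)
    linarith

/-- Every nonzero nonnegative kernel vector has in its support the support of a bounded natural
kernel vector. -/
theorem exists_nat_kernel_vector {κ ι : Type*} [Fintype κ] [Fintype ι]
    (B : Matrix κ ι ℤ) (α r : ℕ) (hα : 1 ≤ α) (hB : ∀ i j, (B i j).natAbs ≤ α)
    (hr : (B.map (Int.cast : ℤ → ℝ)).rank ≤ r) (z : ι → ℝ) (hz0 : ∀ j, 0 ≤ z j)
    (hz : B.map (Int.cast : ℤ → ℝ) *ᵥ z = 0) (hne : z ≠ 0) :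
    ∃ d : ι → ℕ, d ≠ 0 ∧ (∀ j, z j = 0 → d j = 0) ∧
      (∀ j, d j ≤ ⌊(α * Real.sqrt r) ^ r⌋₊) ∧
      B.map (Int.cast : ℤ → ℝ) *ᵥ (fun j => (d j : ℝ)) = 0 := by
  classical
  set R := B.map (Int.cast : ℤ → ℝ) with hR
  induction hN : (Finset.univ.filter fun j => z j ≠ 0).card using Nat.strong_induction_on
    generalizing z with
  | _ N ih =>
  by_cases hmin : ∀ w, R *ᵥ w = 0 → (∀ j, z j = 0 → w j = 0) →
      (∃ j, z j ≠ 0 ∧ w j = 0) → w = 0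
  · exact exists_nat_circuit B α r hα hB hr z hz0 hz hne hmin
  push Not at hmin
  obtain ⟨w, hw, hwz, ⟨j₁, hj₁, hwj₁⟩, hw0⟩ := hmin
  obtain ⟨w', hw', hwz', hwj₁', hpos⟩ : ∃ w', R *ᵥ w' = 0 ∧ (∀ j, z j = 0 → w' j = 0) ∧
      w' j₁ = 0 ∧ ∃ j, 0 < w' j := by
    obtain ⟨j, hj⟩ := Function.ne_iff.1 hw0
    rcases lt_or_gt_of_ne hj with h | h
    · refine ⟨-w, by rw [Matrix.mulVec_neg, hw, neg_zero], fun j hj => ?_, ?_, j, ?_⟩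
      · simp [hwz j hj]
      · simp [hwj₁]
      · simpa using h
    · exact ⟨w, hw, hwz, hwj₁, j, h⟩
  obtain ⟨t, -, hnn, j₂, hj₂, hj₂'⟩ := exists_pos_sub_smul_nonneg z w' hz0 hwz' hpos
  have hsub : ∀ j, z j = 0 → (z - t • w') j = 0 := fun j hj => by simp [hj, hwz' j hj]
  have hlt : (Finset.univ.filter fun j => (z - t • w') j ≠ 0).card < N := by
    rw [← hN]
    apply Finset.card_lt_card
    rw [Finset.ssubset_iff_of_subset]
    · exact ⟨j₂, by simpa using hj₂, by simpa using hj₂'⟩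
    · intro j hj
      simp only [Finset.mem_filter, Finset.mem_univ, true_and] at hj ⊢
      exact fun h => hj (hsub j h)
  obtain ⟨d, hd0, hdz, hd⟩ := ih _ hlt (z - t • w') (by simpa using hnn)
    (Function.ne_iff.2 ⟨j₁, by simpa [hwj₁'] using hj₁⟩)
    (by rw [Matrix.mulVec_sub, Matrix.mulVec_smul, hz, hw']; simp) rfl
  exact ⟨d, hd0, fun j hj => hdz j (hsub j hj), hd⟩

/-- A nonzero nonnegative kernel vector, supported away from the zero columns, is a positive
combination of fewer bounded natural kernel vectors than the size of its support. -/
theorem exists_conic_decomposition {κ ι : Type*} [Fintype κ] [Fintype ι] [DecidableEq ι]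
    (B : Matrix κ ι ℤ) (α r : ℕ) (hα : 1 ≤ α) (hB : ∀ i j, (B i j).natAbs ≤ α)
    (hr : (B.map (Int.cast : ℤ → ℝ)).rank ≤ r) (z : ι → ℝ) (hz0 : ∀ j, 0 ≤ z j)
    (hz : B.map (Int.cast : ℤ → ℝ) *ᵥ z = 0) (hne : z ≠ 0)
    (hcol : ∀ j, z j ≠ 0 → ∃ i, B i j ≠ 0) :
    ∃ (k : ℕ) (l : Fin k → ℝ) (d : Fin k → ι → ℕ),
      k < (Finset.univ.filter fun j => z j ≠ 0).card ∧
      (∀ i, 0 < l i) ∧ (∀ i, d i ≠ 0) ∧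
      (∀ i j, d i j ≤ ⌊(α * Real.sqrt r) ^ r⌋₊) ∧
      (∀ i, B.map (Int.cast : ℤ → ℝ) *ᵥ (fun j => (d i j : ℝ)) = 0) ∧
      ∀ j, z j = ∑ i, l i * d i j := by
  set R := B.map (Int.cast : ℤ → ℝ) with hR
  induction hN : (Finset.univ.filter fun j => z j ≠ 0).card using Nat.strong_induction_on
    generalizing z with
  | _ N ih =>
  have hN1 : 1 < N := by
    obtain ⟨j₀, hj₀⟩ := Function.ne_iff.1 hne
    obtain ⟨i, hi⟩ := hcol j₀ hj₀
    by_contra hcon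
    rw [← hN, not_lt, Finset.card_le_one] at hcon
    have hz' : ∀ j, j ≠ j₀ → z j = 0 := by
      intro j hj
      by_contra h
      exact hj (hcon j (by simpa using h) j₀ (by simpa using hj₀))
    have := congrFun hz i
    rw [Matrix.mulVec, dotProduct, Finset.sum_eq_single j₀ (fun j _ hj => by simp [hz' j hj])
      (by simp)] at this
    rcases mul_eq_zero.1 this with h | h
    · exact hi (by simpa [hR] using h)
    · exact hj₀ h
  obtain ⟨c, hc0, hcz, hcD, hcR⟩ := exists_nat_kernel_vector B α r hα hB hr z hz0 hz hne
  obtain ⟨t, ht, hnn, j₂, hj₂, hj₂'⟩ := exists_pos_sub_smul_nonneg z (fun j => (c j : ℝ)) hz0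
    (fun j hj => by simp [hcz j hj]) (by
      obtain ⟨j, hj⟩ := Function.ne_iff.1 hc0
      exact ⟨j, by exact_mod_cast Nat.pos_of_ne_zero hj⟩)
  by_cases hz' : (fun j => z j - t * c j) = 0
  · refine ⟨1, fun _ => t, fun _ => c, hN1, fun _ => ht, fun _ => hc0, fun _ => hcD,
      fun _ => hcR, fun j => ?_⟩
    have := congrFun hz' j
    simp only [Pi.zero_apply] at this
    simp only [Finset.univ_unique, Finset.sum_const, Finset.card_singleton, one_smul]
    linarith
  have hsub : ∀ j, z j = 0 → z j - t * c j = 0 := fun j hj => by simp [hj, hcz j hj]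
  have hlt : (Finset.univ.filter fun j => z j - t * c j ≠ 0).card < N := by
    rw [← hN]
    apply Finset.card_lt_card
    rw [Finset.ssubset_iff_of_subset]
    · exact ⟨j₂, by simpa using hj₂, by simpa using hj₂'⟩
    · intro j hj
      simp only [Finset.mem_filter, Finset.mem_univ, true_and] at hj ⊢
      exact fun h => hj (hsub j h)
  obtain ⟨k, l, d, hk, hl, hd0, hdD, hdR, hsum⟩ := ih _ hlt (fun j => z j - t * c j) hnn
    hz' (fun j hj => hcol j fun h => hj (hsub j h))
    (by
      have : (fun j => z j - t * c j) = z - t • fun j => (c j : ℝ) := rfl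
      rw [this, Matrix.mulVec_sub, Matrix.mulVec_smul, hz, hcR]; simp) rfl
  refine ⟨k + 1, Fin.cons t l, Fin.cons c d, by omega, ?_, ?_, ?_, ?_, ?_⟩
  · exact Fin.cases (by simpa using ht) (by simpa using hl)
  · exact Fin.cases (by simpa using hc0) (by simpa using hd0)
  · exact Fin.cases (by simpa using hcD) (by simpa using hdD)
  · exact Fin.cases (by simpa using hcR) (by simpa using hdR)
  · intro j
    rw [Fin.sum_univ_succ]
    simp only [Fin.cons_zero, Fin.cons_succ]
    rw [← hsum j]
    ring

theorem mem_eqIntPoints_of_mem_vertN' {m n : ℕ} {A : Matrix (Fin m) (Fin n) ℤ} {b : Fin m → ℤ}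
    {x : Fin n → ℝ} (hx : x ∈ vertN' m n A b) : x ∈ eqIntPoints m n A b :=
  extremePoints_convexHull_subset hx

/-- A vertex is not the midpoint of two other integer points. -/
theorem eq_zero_of_mem_vertN' {m n : ℕ} {A : Matrix (Fin m) (Fin n) ℤ} {b : Fin m → ℤ}
    {x w : Fin n → ℝ} (hx : x ∈ vertN' m n A b) (h₁ : x + w ∈ eqIntPoints m n A b)
    (h₂ : x - w ∈ eqIntPoints m n A b) : w = 0 := by
  have := hx.2 (subset_convexHull ℝ _ h₁) (subset_convexHull ℝ _ h₂)
    ⟨1 / 2, 1 / 2, by norm_num, by norm_num, by norm_num, by ext j; simp; ring⟩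
  simpa using this

/-- An integer solution `w` of the homogeneous system with `|w| ≤ x` vanishes if `x` is a
vertex. -/
theorem eq_zero_of_abs_le_of_mem_vertN' {m n : ℕ} {A : Matrix (Fin m) (Fin n) ℤ} {b : Fin m → ℤ}
    {x w : Fin n → ℝ} (hx : x ∈ vertN' m n A b) (hw : ∀ j, ∃ z : ℤ, w j = z)
    (hA : ∀ i, ∑ j, (A i j : ℝ) * w j = 0) (hle : ∀ j, |w j| ≤ x j) : w = 0 := by
  obtain ⟨hint, hsol, -⟩ := mem_eqIntPoints_of_mem_vertN' hx
  refine eq_zero_of_mem_vertN' hx ⟨fun j => ?_, fun i => ?_, fun j => ?_⟩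
    ⟨fun j => ?_, fun i => ?_, fun j => ?_⟩
  · obtain ⟨a, ha⟩ := hint j
    obtain ⟨c, hc⟩ := hw j
    exact ⟨a + c, by simp [ha, hc]⟩
  · simp [mul_add, Finset.sum_add_distrib, hsol, hA]
  · have := (abs_le.1 (hle j)).1
    simp only [Pi.add_apply]; linarith
  · obtain ⟨a, ha⟩ := hint j
    obtain ⟨c, hc⟩ := hw j
    exact ⟨a - c, by simp [ha, hc]⟩
  · simp [mul_sub, Finset.sum_sub_distrib, hsol, hA]
  · have := (abs_le.1 (hle j)).2
    simp only [Pi.sub_apply]; linarith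

/-- The homogenized matrix `[A | -b]`, the last column being indexed by `none`. -/
def homogenize {m n : ℕ} (A : Matrix (Fin m) (Fin n) ℤ) (b : Fin m → ℤ) :
    Matrix (Fin m) (Option (Fin n)) ℤ :=
  fun i o => o.elim (-b i) (A i)

theorem homogenize_mulVec {m n : ℕ} (A : Matrix (Fin m) (Fin n) ℤ) (b : Fin m → ℤ)
    (z : Option (Fin n) → ℝ) (i : Fin m) :
    ((homogenize A b).map (Int.cast : ℤ → ℝ) *ᵥ z) i =
      ∑ j, (A i j : ℝ) * z (some j) - b i * z none := by
  simp [homogenize, Matrix.mulVec, dotProduct, Fintype.sum_option]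
  ring

theorem rank_homogenize_le {m n : ℕ} (A : Matrix (Fin m) (Fin n) ℤ) (b : Fin m → ℤ)
    (x : Fin n → ℝ) (hx : ∀ i, ∑ j, (A i j : ℝ) * x j = (b i : ℝ)) :
    ((homogenize A b).map (Int.cast : ℤ → ℝ)).rank ≤ (A.map (Int.cast : ℤ → ℝ)).rank := by
  let N : Matrix (Fin n) (Option (Fin n)) ℝ := fun j o => o.elim (-x j) fun j' =>
    (1 : Matrix (Fin n) (Fin n) ℝ) j j'
  have : (homogenize A b).map (Int.cast : ℤ → ℝ) = A.map (Int.cast : ℤ → ℝ) * N := by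
    ext i o
    rw [Matrix.mul_apply]
    cases o with
    | none => simp [homogenize, N, hx]
    | some j => simp [homogenize, N, Matrix.one_apply]
  rw [this]
  exact Matrix.rank_mul_le_left _ _

/-- The coordinates of a nonzero vertex are smaller than `n` times the Hadamard bound for the
subdeterminants of the system. -/
theorem coord_lt_of_mem_vertN' {m n : ℕ} (hn : 2 ≤ n) (A : Matrix (Fin m) (Fin n) ℤ)
    (b : Fin m → ℤ) (α r : ℕ) (hA : ∀ i j, (A i j).natAbs ≤ α) (hb : ∀ i, (b i).natAbs ≤ α)
    (hr : (A.map (Int.cast : ℤ → ℝ)).rank ≤ r) {x : Fin n → ℝ} (hx : x ∈ vertN' m n A b)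
    (hx0 : x ≠ 0) (j : Fin n) : x j < n * ⌊(α * Real.sqrt r) ^ r⌋₊ := by
  obtain ⟨hint, hsol, hnn⟩ := mem_eqIntPoints_of_mem_vertN' hx
  set D := ⌊(α * Real.sqrt r) ^ r⌋₊ with hD
  have hb0 : ∃ i, b i ≠ 0 := by
    by_contra! h
    exact hx0 (eq_zero_of_abs_le_of_mem_vertN' hx hint (fun i => by rw [hsol, h]; simp)
      fun j => (abs_of_nonneg (hnn j)).le)
  have hcolA : ∀ j, x j ≠ 0 → ∃ i, A i j ≠ 0 := by
    intro j hj
    by_contra! h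
    have h0 : (Pi.single j (x j) : Fin n → ℝ) = 0 := by
      refine eq_zero_of_abs_le_of_mem_vertN' hx (fun j' => ?_) (fun i => ?_) fun j' => ?_
      · by_cases h : j' = j
        · subst h; simpa using hint j'
        · exact ⟨0, by simp [h]⟩
      · rw [Finset.sum_eq_single j (fun j' _ h => by simp [h]) (by simp)]
        simp [h i]
      · by_cases h : j' = j
        · subst h; simp [abs_of_nonneg (hnn j')]
        · simp [h, hnn j']
    exact hj (by simpa using h0)
  let z : Option (Fin n) → ℝ := fun o => o.elim 1 x
  have hα : 1 ≤ α := by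
    obtain ⟨i, hi⟩ := hb0
    exact (Nat.one_le_iff_ne_zero.2 (Int.natAbs_ne_zero.2 hi)).trans (hb i)
  obtain ⟨k, l, d, hk, hl, hd0, hdD, hdR, hsum⟩ :=
    exists_conic_decomposition (homogenize A b) α r hα
      (fun i o => by cases o <;> simp [homogenize, hA, hb])
      ((rank_homogenize_le A b x hsol).trans hr) z
      (fun o => by cases o <;> simp [z, hnn])
      (by funext i; rw [homogenize_mulVec]; simp [z, hsol])
      (Function.ne_iff.2 ⟨none, by simp [z]⟩)
      (fun o ho => by
        cases o with
        | none => simpa [homogenize] using hb0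
        | some j => simpa [homogenize] using hcolA j ho)
  have hkn : k ≤ n := by
    have := hk.trans_le (Finset.card_le_univ _)
    simp only [Fintype.card_option, Fintype.card_fin] at this
    omega
  have hterm : ∀ i o, l i * d i o ≤ z o := by
    intro i o
    rw [hsum o]
    exact Finset.single_le_sum (f := fun i => l i * (d i o : ℝ))
      (fun i _ => mul_nonneg (hl i).le (Nat.cast_nonneg _)) (Finset.mem_univ i)
  have hnone : ∀ i, 1 ≤ l i → 1 ≤ d i none := by
    intro i hi
    by_contra! h
    have h0 : d i none = 0 := by omega
    have hw : (fun j => (d i (some j) : ℝ)) = 0 := by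
      refine eq_zero_of_abs_le_of_mem_vertN' hx (fun j => ⟨d i (some j), by simp⟩)
        (fun i' => ?_) fun j => ?_
      · have := congrFun (hdR i) i'
        rw [homogenize_mulVec] at this
        simpa [h0] using this
      · rw [Nat.abs_cast]
        exact (le_mul_of_one_le_left (Nat.cast_nonneg _) hi).trans (hterm i (some j))
    refine hd0 i (funext fun o => ?_)
    cases o with
    | none => exact h0
    | some j => simpa using congrFun hw j
  have hl1 : ∀ i, l i ≤ 1 := by
    intro i
    by_contra! h
    have h1 : (1 : ℝ) ≤ d i none := by exact_mod_cast hnone i h.le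
    have h2 := hterm i none
    simp only [z, Option.elim] at h2
    nlinarith
  have hlsum : ∑ i, l i < n := by
    by_cases hall : ∀ i, l i = 1
    · have h1 : ∑ i, l i ≤ ∑ i, l i * d i none := by
        apply Finset.sum_le_sum
        intro i _
        have : (1 : ℝ) ≤ d i none := by exact_mod_cast hnone i (hall i).ge
        exact le_mul_of_one_le_right (hl i).le this
      rw [← hsum none] at h1
      have h2 : (2 : ℝ) ≤ n := by exact_mod_cast hn
      simp only [z, Option.elim] at h1
      linarith
    · push Not at hall
      obtain ⟨i, hi⟩ := hall
      calc ∑ i, l i < ∑ _i : Fin k, (1 : ℝ) :=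
            Finset.sum_lt_sum (fun i _ => hl1 i) ⟨i, Finset.mem_univ i, lt_of_le_of_ne (hl1 i) hi⟩
        _ = k := by simp
        _ ≤ n := by exact_mod_cast hkn
  have hDpos : 0 < (D : ℝ) := by
    by_contra! h
    have hD0 : D = 0 := by exact_mod_cast le_antisymm h (Nat.cast_nonneg D)
    have := hsum none
    have h0 : ∀ i, d i none = 0 := fun i => by have := hdD i none; omega
    simp [z, h0] at this
  calc x j = ∑ i, l i * d i (some j) := hsum (some j)
    _ ≤ ∑ i, l i * D := by
        apply Finset.sum_le_sum
        intro i _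
        have : (d i (some j) : ℝ) ≤ D := by exact_mod_cast hdD i (some j)
        exact mul_le_mul_of_nonneg_left this (hl i).le
    _ = (∑ i, l i) * D := by rw [Finset.sum_mul]
    _ < n * D := mul_lt_mul_of_pos_right hlsum hDpos

/-- Two vertices of which all coordinates but the first lie in the same dyadic classes
coincide. -/
theorem eq_of_log_eq_of_mem_vertN' {m n : ℕ} {A : Matrix (Fin m) (Fin (n + 1)) ℤ}
    {b : Fin m → ℤ} {x y : Fin (n + 1) → ℝ} (hx : x ∈ vertN' m (n + 1) A b)
    (hy : y ∈ vertN' m (n + 1) A b)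
    (h : ∀ j : Fin n, Nat.log 2 (⌊x j.succ⌋₊ + 1) = Nat.log 2 (⌊y j.succ⌋₊ + 1)) : x = y := by
  wlog hle : y 0 ≤ x 0 generalizing x y
  · exact (this hy hx (fun j => (h j).symm) (le_of_not_ge hle)).symm
  obtain ⟨hxint, hxsol, hxnn⟩ := mem_eqIntPoints_of_mem_vertN' hx
  obtain ⟨hyint, hysol, hynn⟩ := mem_eqIntPoints_of_mem_vertN' hy
  have hfloor : ∀ {t : ℝ}, (∃ z : ℤ, t = z) → 0 ≤ t → ((⌊t⌋₊ : ℕ) : ℝ) = t := by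
    rintro t ⟨z, rfl⟩ ht
    obtain ⟨k, rfl⟩ := Int.eq_ofNat_of_zero_le (by exact_mod_cast ht : 0 ≤ z)
    simp
  refine (sub_eq_zero.1 (eq_zero_of_mem_vertN' (w := y - x) hx ?_ ?_)).symm
  · rw [add_sub_cancel]; exact mem_eqIntPoints_of_mem_vertN' hy
  refine ⟨fun j => ?_, fun i => ?_, fun j => ?_⟩
  · obtain ⟨a, ha⟩ := hxint j
    obtain ⟨c, hc⟩ := hyint j
    exact ⟨a - (c - a), by simp [ha, hc]⟩
  · simp [mul_sub, Finset.sum_sub_distrib, hxsol, hysol]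
  · simp only [Pi.sub_apply]
    refine Fin.cases ?_ (fun j => ?_) j
    · linarith [hxnn 0]
    · have h1 := Nat.pow_log_le_self 2 (Nat.succ_ne_zero ⌊x j.succ⌋₊)
      have h2 := Nat.lt_pow_succ_log_self (b := 2) (by norm_num) (⌊y j.succ⌋₊ + 1)
      rw [← h j, pow_succ] at h2
      have h3 : ⌊y j.succ⌋₊ ≤ 2 * ⌊x j.succ⌋₊ := by
        simp only [Nat.succ_eq_add_one] at h1
        omega
      have h4 : ((⌊y j.succ⌋₊ : ℕ) : ℝ) ≤ 2 * ⌊x j.succ⌋₊ := by exact_mod_cast h3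
      rw [hfloor (hyint _) (hynn _), hfloor (hxint _) (hxnn _)] at h4
      linarith

theorem card_vertN__le (m n : ℕ) (A : Matrix (Fin m) (Fin n) ℤ) (b : Fin m → ℤ)
    (r : ℕ) (hr : r = (A.map (Int.cast : ℤ → ℝ)).rank)
    (α : ℕ)
    (hα : α = (Finset.univ.sup fun p : Fin m × Fin n => (A p.1 p.2).natAbs) ⊔
          Finset.univ.sup fun i => (b i).natAbs) :
    (vertN' m n A b).Finite ∧
      ((vertN' m n A b).ncard : ℝ) ≤
        (1 + Real.logb 2 n + r * Real.logb 2 (α * Real.sqrt r)) ^ (n - 1) := by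
  have hA : ∀ i j, (A i j).natAbs ≤ α := fun i j => by
    rw [hα]
    exact le_sup_of_le_left (Finset.le_sup (f := fun p : Fin m × Fin n => (A p.1 p.2).natAbs)
      (Finset.mem_univ (i, j)))
  have hb : ∀ i, (b i).natAbs ≤ α := fun i => by
    rw [hα]
    exact le_sup_of_le_right (Finset.le_sup (f := fun i => (b i).natAbs) (Finset.mem_univ i))
  rcases n with _ | n
  · refine ⟨Set.toFinite _, ?_⟩
    have : (vertN' m 0 A b).ncard ≤ 1 :=
      Set.ncard_le_one_of_subsingleton _
    simpa using this
  have hbase : r = 0 ∨ (1 : ℝ) ≤ α * Real.sqrt r := by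
    rcases Nat.eq_zero_or_pos r with h0 | h0
    · exact Or.inl h0
    · right
      have hA0 : ∃ i j, A i j ≠ 0 := by
        by_contra! h
        have : A = 0 := by ext i j; exact h i j
        rw [this] at hr
        simp at hr
        omega
      obtain ⟨i, j, hij⟩ := hA0
      have h1 : (1 : ℝ) ≤ α := by
        exact_mod_cast (Nat.one_le_iff_ne_zero.2 (Int.natAbs_ne_zero.2 hij)).trans (hA i j)
      have h2 : (1 : ℝ) ≤ Real.sqrt r := Real.one_le_sqrt.2 (by exact_mod_cast h0)
      nlinarith
  have hD1 : (1 : ℝ) ≤ (α * Real.sqrt r) ^ r := by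
    rcases hbase with h | h
    · simp [h]
    · exact one_le_pow₀ h
  have hn1 : (1 : ℝ) ≤ ((n + 1 : ℕ) : ℝ) := by simp
  set L := Real.logb 2 (n + 1 : ℕ) + r * Real.logb 2 (α * Real.sqrt r) with hL
  have hLeq : L = Real.logb 2 ((n + 1 : ℕ) * (α * Real.sqrt r) ^ r) := by
    rw [Real.logb_mul (by positivity) (by positivity), Real.logb_pow]
  have hL0 : 0 ≤ L := by
    rw [hLeq]
    exact Real.logb_nonneg (by norm_num) (one_le_mul_of_one_le_of_one_le hn1 hD1)
  have hbound : ∀ x ∈ vertN' m (n + 1) A b, ∀ j : Fin n,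
      Nat.log 2 (⌊x j.succ⌋₊ + 1) < ⌊L⌋₊ + 1 := by
    intro x hx j
    have h1 : ⌊x j.succ⌋₊ + 1 ≤ (n + 1) * ⌊(α * Real.sqrt r) ^ r⌋₊ := by
      by_cases hx0 : x = 0
      · have : 1 ≤ ⌊(α * Real.sqrt r) ^ r⌋₊ := Nat.le_floor (by simpa using hD1)
        subst hx0
        simp only [Pi.zero_apply, Nat.floor_zero]
        nlinarith
      · have hn : 2 ≤ n + 1 := by have := j.2; omega
        have := coord_lt_of_mem_vertN' hn A b α r hA hb hr.ge hx hx0 j.succ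
        have h0 := (mem_eqIntPoints_of_mem_vertN' hx).2.2 j.succ
        rw [Nat.succ_le_iff, Nat.floor_lt h0]
        exact_mod_cast this
    rw [Nat.lt_succ_iff]
    apply Nat.le_floor
    rw [hLeq, Real.le_logb_iff_rpow_le (by norm_num) (by positivity), Real.rpow_natCast]
    calc (2 : ℝ) ^ Nat.log 2 (⌊x j.succ⌋₊ + 1) ≤ ((⌊x j.succ⌋₊ + 1 : ℕ) : ℝ) := by
          exact_mod_cast Nat.pow_log_le_self 2 (Nat.succ_ne_zero _)
      _ ≤ (((n + 1) * ⌊(α * Real.sqrt r) ^ r⌋₊ : ℕ) : ℝ) := by exact_mod_cast h1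
      _ ≤ (n + 1 : ℕ) * (α * Real.sqrt r) ^ r := by
          rw [Nat.cast_mul]
          exact mul_le_mul_of_nonneg_left (Nat.floor_le (by positivity)) (by positivity)
  let F : vertN' m (n + 1) A b → (Fin n → Fin (⌊L⌋₊ + 1)) := fun x j =>
    ⟨Nat.log 2 (⌊x.1 j.succ⌋₊ + 1), hbound x.1 x.2 j⟩
  have hF : Function.Injective F := fun x y hxy =>
    Subtype.ext (eq_of_log_eq_of_mem_vertN' x.2 y.2 fun j => congrArg Fin.val (congrFun hxy j))
  have hfin : Finite (vertN' m (n + 1) A b) := Finite.of_injective F hF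
  refine ⟨Set.toFinite _, ?_⟩
  have hcard : (vertN' m (n + 1) A b).ncard ≤ (⌊L⌋₊ + 1) ^ n := by
    have := Nat.card_le_card_of_injective F hF
    simpa [Nat.card_coe_set_eq] using this
  calc ((vertN' m (n + 1) A b).ncard : ℝ) ≤ (((⌊L⌋₊ + 1) ^ n : ℕ) : ℝ) := by exact_mod_cast hcard
    _ = ((⌊L⌋₊ : ℝ) + 1) ^ n := by push_cast; rfl
    _ ≤ (L + 1) ^ n := by
        have := Nat.floor_le hL0
        gcongr
    _ = _ := by rw [hL, Nat.add_sub_cancel]; congr 1; ring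
end

section
/- For every natural number $k \ge 1$, the convex hull of the set of points $(x,y) \in \mathbb{Z}^2$ with $x \ge 0$, $y \ge 0$ and $F_{2k}\,x + F_{2k+1}\,y \le F_{2k+1}^2 - 1$ has exactly $k + 3$ vertices (extreme points), where $F_s$ denotes the $s$-th Fibonacci number ($F_1 = F_2 = 1$, $F_s = F_{s-1} + F_{s-2}$ for $s \ge 3$). -/
open Set

/-- A point of a planar set at which two linear functionals with independent normals attain their
maximum over the set is an extreme point of its convex hull. -/
theorem mem_extremePoints_convexHull_of_two_normals {S : Set (ℝ × ℝ)} {p : ℝ × ℝ} (hp : p ∈ S)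
    (a b c d : ℝ) (hdet : a * d - b * c ≠ 0)
    (h₁ : ∀ q ∈ S, a * q.1 + b * q.2 ≤ a * p.1 + b * p.2)
    (h₂ : ∀ q ∈ S, c * q.1 + d * q.2 ≤ c * p.1 + d * p.2) :
    p ∈ extremePoints ℝ (convexHull ℝ S) := by
  have halfspace : ∀ m n : ℝ, (∀ q ∈ S, m * q.1 + n * q.2 ≤ m * p.1 + n * p.2) →
      ∀ q ∈ convexHull ℝ S, m * q.1 + n * q.2 ≤ m * p.1 + n * p.2 := by
    intro m n h
    have hconv : Convex ℝ {q : ℝ × ℝ | m * q.1 + n * q.2 ≤ m * p.1 + n * p.2} := by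
      refine convex_halfSpace_le (f := fun q : ℝ × ℝ => m * q.1 + n * q.2) ⟨?_, ?_⟩ _
      · intro x y
        simp only [Prod.fst_add, Prod.snd_add]
        ring
      · intro r x
        simp only [Prod.smul_fst, Prod.smul_snd, smul_eq_mul]
        ring
    exact fun q hq => convexHull_min h hconv hq
  have tight : ∀ m n : ℝ, (∀ q ∈ S, m * q.1 + n * q.2 ≤ m * p.1 + n * p.2) →
      ∀ x ∈ convexHull ℝ S, ∀ y ∈ convexHull ℝ S, ∀ r s : ℝ, 0 < r → 0 < s → r + s = 1 →
        r • x + s • y = p → m * x.1 + n * x.2 = m * p.1 + n * p.2 := by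
    intro m n h x hx y hy r s hr hs hrs hxy
    have hx' := halfspace m n h x hx
    have hy' := halfspace m n h y hy
    have e₁ : r * x.1 + s * y.1 = p.1 := by rw [← hxy]; simp
    have e₂ : r * x.2 + s * y.2 = p.2 := by rw [← hxy]; simp
    have e : r * (m * x.1 + n * x.2) + s * (m * y.1 + n * y.2) = m * p.1 + n * p.2 := by
      rw [← e₁, ← e₂]; ring
    refine le_antisymm hx' ?_
    have hs' : s = 1 - r := by linarith
    subst hs'
    have := mul_le_mul_of_nonneg_left hy' hs.le
    refine le_of_mul_le_mul_left ?_ hr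
    linarith
  refine ⟨subset_convexHull ℝ S hp, ?_⟩
  rintro x hx y hy ⟨r, s, hr, hs, hrs, hxy⟩
  have t₁ := tight a b h₁ x hx y hy r s hr hs hrs hxy
  have t₂ := tight c d h₂ x hx y hy r s hr hs hrs hxy
  refine Prod.ext (mul_left_cancel₀ hdet ?_) (mul_left_cancel₀ hdet ?_)
  · linear_combination d * t₁ - b * t₂
  · linear_combination a * t₂ - c * t₁

theorem fib_two_mul_succ (j : ℕ) :
    Nat.fib (2 * (j + 1)) = Nat.fib (2 * j) + Nat.fib (2 * j + 1) :=
  Nat.fib_add_two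

theorem fib_two_mul_succ_add_one (j : ℕ) :
    Nat.fib (2 * (j + 1) + 1) = Nat.fib (2 * j) + 2 * Nat.fib (2 * j + 1) := by
  have : Nat.fib (2 * (j + 1) + 1) = Nat.fib (2 * j + 1) + Nat.fib (2 * j + 2) := Nat.fib_add_two
  rw [this, Nat.fib_add_two]
  ring

theorem fib_cassini_odd (j : ℕ) :
    (Nat.fib (2 * j + 1) : ℤ) ^ 2 - Nat.fib (2 * j) * Nat.fib (2 * j + 1)
      - Nat.fib (2 * j) ^ 2 = 1 := by
  induction j with
  | zero => simp
  | succ j ih =>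
    rw [fib_two_mul_succ, fib_two_mul_succ_add_one]
    push_cast
    linear_combination ih

theorem fib_cross_eq (j m : ℕ) :
    (Nat.fib (2 * j + 1) : ℤ) * Nat.fib (2 * (j + m)) - Nat.fib (2 * j) * Nat.fib (2 * (j + m) + 1)
      = Nat.fib (2 * m) := by
  induction j with
  | zero => simp
  | succ j ih =>
    rw [show j + 1 + m = j + m + 1 by ring]
    simp only [fib_two_mul_succ, fib_two_mul_succ_add_one]
    push_cast
    linear_combination ih

theorem fib_slack_eq (j m : ℕ) :
    (Nat.fib (2 * (j + m) + 1) : ℤ) * (Nat.fib (2 * j + 1) - Nat.fib (2 * j))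
      - Nat.fib (2 * (j + m)) * Nat.fib (2 * j) = Nat.fib (2 * m + 1) := by
  induction j with
  | zero => simp
  | succ j ih =>
    rw [show j + 1 + m = j + m + 1 by ring]
    simp only [fib_two_mul_succ, fib_two_mul_succ_add_one]
    push_cast
    linear_combination ih

theorem fib_two_mul_strictMono : StrictMono fun j : ℕ => Nat.fib (2 * j) := by
  refine strictMono_nat_of_lt_succ fun j => ?_
  have : 0 < Nat.fib (2 * j + 1) := Nat.fib_pos.2 (by omega)
  simp only [fib_two_mul_succ]
  omega

/-- The lattice points of the triangle cut out by consecutive Fibonacci numbers. -/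
def fibTriangle (k : ℕ) : Set (ℝ × ℝ) :=
  {p : ℝ × ℝ | (∃ x : ℤ, p.1 = (x : ℝ)) ∧ (∃ y : ℤ, p.2 = (y : ℝ)) ∧
    0 ≤ p.1 ∧ 0 ≤ p.2 ∧
    (Nat.fib (2 * k) : ℝ) * p.1 + (Nat.fib (2 * k + 1) : ℝ) * p.2 ≤
      (Nat.fib (2 * k + 1) : ℝ) ^ 2 - 1}

/-- The vertices other than the origin, ordered by their first coordinate; the second coordinate
is `F (2k+1) - F (2j-1)`, with `F (-1) = 1`. -/
def fibVertex (k j : ℕ) : ℝ × ℝ :=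
  (Nat.fib (2 * j), Nat.fib (2 * k + 1) - (Nat.fib (2 * j + 1) - Nat.fib (2 * j)))

/-- Every lattice point of the triangle lies below the line through two consecutive vertices. -/
theorem fibTriangle_edge_le {k j : ℕ} (hj : j ≤ k) {p : ℝ × ℝ} (hp : p ∈ fibTriangle k) :
    (Nat.fib (2 * j) : ℝ) * p.1 + (Nat.fib (2 * j + 1) : ℝ) * p.2 ≤
      (Nat.fib (2 * j + 1) : ℝ) * Nat.fib (2 * k + 1) - 1 := by
  obtain ⟨p₁, p₂⟩ := p
  obtain ⟨⟨x, hx⟩, ⟨y, hy⟩, hx0, hy0, h⟩ := hp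
  dsimp only at *
  subst hx hy
  have hx0 : 0 ≤ x := by exact_mod_cast hx0
  have h : (Nat.fib (2 * k) : ℤ) * x + Nat.fib (2 * k + 1) * y ≤ Nat.fib (2 * k + 1) ^ 2 - 1 := by
    exact_mod_cast h
  suffices H : (Nat.fib (2 * j) : ℤ) * x + Nat.fib (2 * j + 1) * y <
      Nat.fib (2 * j + 1) * Nat.fib (2 * k + 1) by
    have H : (Nat.fib (2 * j) : ℤ) * x + Nat.fib (2 * j + 1) * y ≤
      Nat.fib (2 * j + 1) * Nat.fib (2 * k + 1) - 1 := by omega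
    exact_mod_cast H
  obtain ⟨m, rfl⟩ := Nat.exists_eq_add_of_le hj
  have hcross := fib_cross_eq j m
  have hm : (0 : ℤ) ≤ Nat.fib (2 * m) := by positivity
  have hs : (0 : ℤ) ≤ Nat.fib (2 * j) := by positivity
  have ht : (0 : ℤ) < Nat.fib (2 * j + 1) := by exact_mod_cast Nat.fib_pos.2 (by omega)
  have hb : (0 : ℤ) < Nat.fib (2 * (j + m) + 1) := by exact_mod_cast Nat.fib_pos.2 (by omega)
  generalize (Nat.fib (2 * j) : ℤ) = s at *
  generalize (Nat.fib (2 * j + 1) : ℤ) = t at *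
  generalize (Nat.fib (2 * (j + m)) : ℤ) = a at *
  generalize (Nat.fib (2 * (j + m) + 1) : ℤ) = b at *
  -- scaled by `b`, the claim is `s x b ≤ t a x < t b (b - y)`
  have h₁ : 0 ≤ (t * a - s * b) * x := by rw [hcross]; positivity
  have h₂ : 0 < t * (b ^ 2 - a * x - b * y) := mul_pos ht (by linarith)
  by_contra! hcon
  have h₃ := mul_le_mul_of_nonneg_left hcon hb.le
  nlinarith

theorem fibVertex_on_edge_left (k j : ℕ) :
    (Nat.fib (2 * j) : ℝ) * (fibVertex k j).1 + (Nat.fib (2 * j + 1) : ℝ) * (fibVertex k j).2 =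
      (Nat.fib (2 * j + 1) : ℝ) * Nat.fib (2 * k + 1) - 1 := by
  have h : (Nat.fib (2 * j + 1) : ℝ) ^ 2 - Nat.fib (2 * j) * Nat.fib (2 * j + 1)
      - Nat.fib (2 * j) ^ 2 = 1 := by exact_mod_cast fib_cassini_odd j
  simp only [fibVertex]
  linear_combination -h

theorem fibVertex_succ (k j : ℕ) :
    fibVertex k (j + 1) = ((fibVertex k j).1 + Nat.fib (2 * j + 1),
      (fibVertex k j).2 - Nat.fib (2 * j)) := by
  simp only [fibVertex, fib_two_mul_succ, fib_two_mul_succ_add_one, Prod.mk.injEq]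
  push_cast
  constructor <;> ring

theorem fibVertex_on_edge_right (k j : ℕ) :
    (Nat.fib (2 * j) : ℝ) * (fibVertex k (j + 1)).1 +
        (Nat.fib (2 * j + 1) : ℝ) * (fibVertex k (j + 1)).2 =
      (Nat.fib (2 * j + 1) : ℝ) * Nat.fib (2 * k + 1) - 1 := by
  rw [← fibVertex_on_edge_left, fibVertex_succ]
  ring

theorem fibVertex_last (k : ℕ) : fibVertex k (k + 1) = ((Nat.fib (2 * (k + 1)) : ℝ), 0) := by
  simp only [fibVertex, fib_two_mul_succ, fib_two_mul_succ_add_one, Prod.mk.injEq, true_and]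
  push_cast
  ring

theorem fibVertex_snd_nonneg {k j : ℕ} (hj : j ≤ k + 1) : 0 ≤ (fibVertex k j).2 := by
  have anti : Antitone fun j => (fibVertex k j).2 := by
    refine antitone_nat_of_succ_le fun i => ?_
    rw [fibVertex_succ]
    simp
  have := anti hj
  simpa [fibVertex_last] using this

theorem fibVertex_mem {k j : ℕ} (hj : j ≤ k + 1) : fibVertex k j ∈ fibTriangle k := by
  refine ⟨⟨Nat.fib (2 * j), by simp [fibVertex]⟩,
    ⟨Nat.fib (2 * k + 1) - (Nat.fib (2 * j + 1) - Nat.fib (2 * j)), by simp [fibVertex]⟩,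
    by simp [fibVertex], fibVertex_snd_nonneg hj, ?_⟩
  rcases Nat.lt_or_ge k j with h | h
  · obtain rfl : j = k + 1 := by omega
    rw [fibVertex_on_edge_right, sq]
  · obtain ⟨m, rfl⟩ := Nat.exists_eq_add_of_le h
    have e : (Nat.fib (2 * (j + m) + 1) : ℝ) * (Nat.fib (2 * j + 1) - Nat.fib (2 * j))
      - Nat.fib (2 * (j + m)) * Nat.fib (2 * j) = Nat.fib (2 * m + 1) := by
        exact_mod_cast fib_slack_eq j m
    have : (1 : ℝ) ≤ Nat.fib (2 * m + 1) := by exact_mod_cast Nat.fib_pos.2 (by omega)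
    simp only [fibVertex]
    linarith

theorem origin_mem_fibTriangle (k : ℕ) : (0 : ℝ × ℝ) ∈ fibTriangle k := by
  have : (1 : ℝ) ≤ Nat.fib (2 * k + 1) := by exact_mod_cast Nat.fib_pos.2 (by omega)
  refine ⟨⟨0, by simp⟩, ⟨0, by simp⟩, le_rfl, le_rfl, ?_⟩
  simp only [Prod.fst_zero, Prod.snd_zero]
  nlinarith

/-- The vertex set of the hull of `fibTriangle k`. -/
def fibVertices (k : ℕ) : Set (ℝ × ℝ) :=
  insert 0 (fibVertex k '' Iio (k + 2))

theorem fibVertices_subset (k : ℕ) : fibVertices k ⊆ fibTriangle k := by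
  refine insert_subset (origin_mem_fibTriangle k) ?_
  rintro _ ⟨j, hj, rfl⟩
  exact fibVertex_mem (by simp only [mem_Iio] at hj; omega)

theorem fibVertices_subset_extremePoints {k : ℕ} (hk : 1 ≤ k) :
    fibVertices k ⊆ extremePoints ℝ (convexHull ℝ (fibTriangle k)) := by
  refine insert_subset ?_ ?_
  · refine mem_extremePoints_convexHull_of_two_normals (origin_mem_fibTriangle k)
      (-1) 0 0 (-1) (by norm_num) ?_ ?_ <;>
    · rintro q ⟨-, -, h₁, h₂, -⟩
      simp [h₁, h₂]
  rintro _ ⟨j, hj, rfl⟩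
  simp only [mem_Iio] at hj
  have hmem := fibVertex_mem (show j ≤ k + 1 by omega)
  have left : ∀ i, i ≤ k → ∀ q ∈ fibTriangle k, (Nat.fib (2 * i) : ℝ) * q.1 +
      Nat.fib (2 * i + 1) * q.2 ≤ Nat.fib (2 * i) * (fibVertex k i).1 +
        Nat.fib (2 * i + 1) * (fibVertex k i).2 := by
    intro i hi q hq
    rw [fibVertex_on_edge_left]
    exact fibTriangle_edge_le hi hq
  have right : ∀ i, i ≤ k → ∀ q ∈ fibTriangle k, (Nat.fib (2 * i) : ℝ) * q.1 +
      Nat.fib (2 * i + 1) * q.2 ≤ Nat.fib (2 * i) * (fibVertex k (i + 1)).1 +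
        Nat.fib (2 * i + 1) * (fibVertex k (i + 1)).2 := by
    intro i hi q hq
    rw [fibVertex_on_edge_right]
    exact fibTriangle_edge_le hi hq
  rcases j with _ | i
  · refine mem_extremePoints_convexHull_of_two_normals hmem (-1) 0 _ _ ?_ ?_ (left 0 (by omega))
    · simp
    · rintro q ⟨-, -, h₁, -, -⟩
      simpa [fibVertex] using h₁
  rcases Nat.lt_or_ge i k with h | h
  · refine mem_extremePoints_convexHull_of_two_normals hmem _ _ _ _ ?_ (right i (by omega))
      (left (i + 1) (by omega))
    have e : (Nat.fib (2 * i + 1) : ℝ) ^ 2 - Nat.fib (2 * i) * Nat.fib (2 * i + 1)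
      - Nat.fib (2 * i) ^ 2 = 1 := by exact_mod_cast fib_cassini_odd i
    rw [fib_two_mul_succ, fib_two_mul_succ_add_one]
    push_cast
    intro h0
    linarith
  · obtain rfl : i = k := by omega
    refine mem_extremePoints_convexHull_of_two_normals hmem _ _ 0 (-1) ?_ (right i le_rfl) ?_
    · have : (0 : ℝ) < Nat.fib (2 * i) := by exact_mod_cast Nat.fib_pos.2 (by omega)
      intro h0
      linarith
    · rintro q ⟨-, -, -, h₂, -⟩
      simpa [fibVertex_last] using h₂

theorem fibTriangle_subset_convexHull {k : ℕ} (hk : 1 ≤ k) :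
    fibTriangle k ⊆ convexHull ℝ (fibVertices k) := by
  intro p hp
  have hconv := convex_convexHull ℝ (fibVertices k)
  have hv : ∀ j, j ≤ k + 1 → fibVertex k j ∈ convexHull ℝ (fibVertices k) := fun j hj =>
    subset_convexHull ℝ _ (mem_insert_of_mem _ ⟨j, by simp only [mem_Iio]; omega, rfl⟩)
  have h0 : (0 : ℝ × ℝ) ∈ convexHull ℝ (fibVertices k) :=
    subset_convexHull ℝ _ (mem_insert _ _)
  have hx0 : 0 ≤ p.1 := hp.2.2.1
  have hy0 : 0 ≤ p.2 := hp.2.2.2.1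
  have hs : (0 : ℝ) < Nat.fib (2 * k) := by exact_mod_cast Nat.fib_pos.2 (by omega)
  have hlast : (0 : ℝ) < Nat.fib (2 * (k + 1)) := by exact_mod_cast Nat.fib_pos.2 (by omega)
  have hxle : p.1 ≤ Nat.fib (2 * (k + 1)) := by
    have h₁ := fibTriangle_edge_le le_rfl hp
    rw [← fibVertex_on_edge_right, fibVertex_last] at h₁
    have : (0 : ℝ) ≤ Nat.fib (2 * k + 1) * p.2 := by positivity
    refine le_of_mul_le_mul_left ?_ hs
    linarith
  obtain ⟨j, hj, hjl, hjr⟩ : ∃ j ≤ k, (fibVertex k j).1 ≤ p.1 ∧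
      p.1 ≤ (fibVertex k (j + 1)).1 := by
    have key : ∀ n : ℕ, p.1 ≤ Nat.fib (2 * (n + 1)) → ∃ j ≤ n, (fibVertex k j).1 ≤ p.1 ∧
      p.1 ≤ (fibVertex k (j + 1)).1 := by
      intro n
      induction n with
      | zero => exact fun h => ⟨0, le_rfl, by simpa [fibVertex] using hx0, h⟩
      | succ n ih =>
        intro h
        rcases le_total p.1 (Nat.fib (2 * (n + 1))) with h' | h'
        · obtain ⟨j, hj, h''⟩ := ih h'
          exact ⟨j, by omega, h''⟩
        · exact ⟨n + 1, le_rfl, h', h⟩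
    exact key k hxle
  have ht : (0 : ℝ) < Nat.fib (2 * j + 1) := by exact_mod_cast Nat.fib_pos.2 (by omega)
  -- the points of the boundary below and above `p`
  have hbot : ((p.1, 0) : ℝ × ℝ) ∈ convexHull ℝ (fibVertices k) := by
    have hl := hv (k + 1) le_rfl
    rw [fibVertex_last] at hl
    have := hconv h0 hl (a := 1 - p.1 / Nat.fib (2 * (k + 1))) (b := p.1 / Nat.fib (2 * (k + 1)))
      (sub_nonneg.2 ((div_le_one hlast).2 hxle)) (by positivity) (by ring)
    convert this using 1
    ext <;> simp
  set r := (p.1 - (fibVertex k j).1) / Nat.fib (2 * j + 1) with hr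
  have hrt : r * Nat.fib (2 * j + 1) = p.1 - (fibVertex k j).1 := by
    rw [hr]; field_simp
  set y := (fibVertex k j).2 - r * Nat.fib (2 * j) with hy
  have htop : ((p.1, y) : ℝ × ℝ) ∈ convexHull ℝ (fibVertices k) := by
    have hr0 : 0 ≤ r := div_nonneg (by linarith) ht.le
    have hr1 : r ≤ 1 := by
      rw [hr, div_le_one ht]
      rw [fibVertex_succ] at hjr
      dsimp only at hjr
      linarith
    have := hconv (hv j (by omega)) (hv (j + 1) (by omega)) (a := 1 - r) (b := r)
      (by linarith) hr0 (by ring)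
    convert this using 1
    rw [fibVertex_succ]
    ext
    · simp only [Prod.fst_add, Prod.smul_fst, smul_eq_mul]
      linear_combination -hrt
    · simp only [Prod.snd_add, Prod.smul_snd, smul_eq_mul]
      rw [hy]; ring
  have hpy : p.2 ≤ y := by
    have h₁ := fibTriangle_edge_le hj hp
    rw [← fibVertex_on_edge_left] at h₁
    refine le_of_mul_le_mul_left ?_ ht
    have : (Nat.fib (2 * j + 1) : ℝ) * y = Nat.fib (2 * j + 1) * (fibVertex k j).2 -
        Nat.fib (2 * j) * (p.1 - (fibVertex k j).1) := by
      rw [← hrt, hy]; ring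
    linarith
  rcases hy0.eq_or_lt with h | h
  · convert hbot using 1
    exact Prod.ext rfl h.symm
  · have hy' : 0 < y := h.trans_le hpy
    have := hconv hbot htop (a := 1 - p.2 / y) (b := p.2 / y)
      (sub_nonneg.2 ((div_le_one hy').2 hpy)) (by positivity) (by ring)
    convert this using 1
    ext
    · simp only [Prod.fst_add, Prod.smul_fst, smul_eq_mul]
      ring
    · simp only [Prod.snd_add, Prod.smul_snd, smul_eq_mul]
      field_simp
      ring

theorem extremePoints_fibTriangle {k : ℕ} (hk : 1 ≤ k) :
    extremePoints ℝ (convexHull ℝ (fibTriangle k)) = fibVertices k := by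
  refine Subset.antisymm ?_ (fibVertices_subset_extremePoints hk)
  have h : convexHull ℝ (fibTriangle k) = convexHull ℝ (fibVertices k) :=
    Subset.antisymm (convexHull_min (fibTriangle_subset_convexHull hk) (convex_convexHull ℝ _))
      (convexHull_mono (fibVertices_subset k))
  rw [h]
  exact extremePoints_convexHull_subset

theorem ncard_fibVertices {k : ℕ} (hk : 1 ≤ k) : (fibVertices k).ncard = k + 3 := by
  have hinj : Function.Injective (fibVertex k) := by
    intro i j h
    have : (Nat.fib (2 * i) : ℝ) = Nat.fib (2 * j) := congrArg Prod.fst h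
    exact fib_two_mul_strictMono.injective (by exact_mod_cast this)
  have h0 : (0 : ℝ × ℝ) ∉ fibVertex k '' Iio (k + 2) := by
    rintro ⟨j, -, h⟩
    have h₁ : (Nat.fib (2 * j) : ℝ) = 0 := congrArg Prod.fst h
    have h₂ : Nat.fib (2 * j) = 0 := by exact_mod_cast h₁
    obtain rfl : j = 0 := by have := Nat.fib_eq_zero.1 h₂; omega
    have h₃ : (Nat.fib (2 * k + 1) : ℝ) - (1 - 0) = 0 := by
      simpa [fibVertex] using congrArg Prod.snd h
    have h₄ : (Nat.fib (2 * k + 1) : ℝ) = 1 := by linarith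
    have h₅ : Nat.fib (2 * k + 1) = 1 := by exact_mod_cast h₄
    have h₆ : Nat.fib 3 ≤ Nat.fib (2 * k + 1) := Nat.fib_mono (by omega)
    have h₇ : Nat.fib 3 = 2 := rfl
    omega
  rw [fibVertices, ncard_insert_of_notMem h0 ((finite_Iio _).image _),
    ncard_image_of_injective _ hinj, ← Finset.coe_Iio, ncard_coe_finset, Nat.card_Iio]

theorem rubin_fibonacci_vertices (k : ℕ) (hk : 1 ≤ k) :
    (Set.extremePoints ℝ (convexHull ℝ
      {p : ℝ × ℝ | (∃ x : ℤ, p.1 = (x : ℝ)) ∧ (∃ y : ℤ, p.2 = (y : ℝ)) ∧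
        0 ≤ p.1 ∧ 0 ≤ p.2 ∧
        (Nat.fib (2 * k) : ℝ) * p.1 + (Nat.fib (2 * k + 1) : ℝ) * p.2 ≤
          (Nat.fib (2 * k + 1) : ℝ) ^ 2 - 1})).ncard = k + 3 := by
  change (extremePoints ℝ (convexHull ℝ (fibTriangle k))).ncard = k + 3
  rw [extremePoints_fibTriangle hk, ncard_fibVertices hk]
end
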